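/- Let τ_1 and τ_2 be self-adjoint operators with Hilbert–Schmidt inverses r_1, r_2, integral traces 𝔱_1, 𝔱_2, and secular functions ζ_i(z) = e^{−z𝔱_i} det₂(I − z r_i). Then there is a universal constant a > 1 such that for all z ∈ ℂ, |ζ_1(z) − ζ_2(z)| ≤ (e^{|z||𝔱_1−𝔱_2|} − 1 + |z|‖r_1 − r_2‖_{HS}) · a^{|z|²(‖r_1‖²_{HS} + ‖r_2‖²_{HS}) + |z|(|𝔱_1|+|𝔱_2|) + 1}. -/

import Mathlib

open Filter Topology

lemma aux_hasSum_prod {α β : Type*} {f : α × β → ℝ} (hf : ∀ p, 0 ≤ f p) {g : α → ℝ} {c : ℝ}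
    (h1 : ∀ a, HasSum (fun b => f (a, b)) (g a)) (h2 : HasSum g c) : HasSum f c := by
  have hs : Summable f := by
    rw [summable_prod_of_nonneg (fun p => hf p)]
    refine ⟨fun a => (h1 a).summable, ?_⟩
    simp_rw [fun a => (h1 a).tsum_eq]
    exact h2.summable
  have h3 := hs.hasSum.prod_fiberwise h1
  rw [h2.unique h3]
  exact hs.hasSum

lemma aux_parseval {H : Type*} [NormedAddCommGroup H] [InnerProductSpace ℝ H]
    (b : HilbertBasis ℤ ℝ H) (x : H) :
    HasSum (fun k => (inner ℝ (b k) x) ^ 2) (‖x‖ ^ 2) := by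
  have h := b.hasSum_inner_mul_inner x x
  rw [real_inner_self_eq_norm_sq] at h
  have e : (fun k => (inner ℝ (b k) x) ^ 2) = fun k => inner ℝ x (b k) * inner ℝ (b k) x := by
    funext k
    rw [real_inner_comm x (b k), sq]
  rw [e]
  exact h

lemma aux_hs {H : Type*} [NormedAddCommGroup H] [InnerProductSpace ℝ H] [CompleteSpace H]
    (T : H →L[ℝ] H) (hT : IsSelfAdjoint T) (b d : HilbertBasis ℤ ℝ H) {c : ℝ}
    (h : HasSum (fun k => ‖T (b k)‖ ^ 2) c) : HasSum (fun k => ‖T (d k)‖ ^ 2) c := by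
  have h1 : HasSum (fun p : ℤ × ℤ => (inner ℝ (d p.2) (T (b p.1))) ^ 2) c :=
    aux_hasSum_prod (fun p => sq_nonneg _) (fun k => aux_parseval d (T (b k))) h
  have h2 : HasSum (fun p : ℤ × ℤ => (inner ℝ (d p.1) (T (b p.2))) ^ 2) c :=
    (Equiv.prodComm ℤ ℤ).hasSum_iff.mpr h1
  refine h2.prod_fiberwise (fun j => ?_)
  convert aux_parseval b (T (d j)) using 2 with k
  have : inner ℝ (T (d j)) (b k) = inner ℝ (d j) (T (b k)) :=
    (ContinuousLinearMap.isSelfAdjoint_iff_isSymmetric.mp hT) (d j) (b k)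
  simp only
  rw [← this, real_inner_comm]

lemma aux_birkhoff {ι : Type*} [Fintype ι] [DecidableEq ι] (M : Matrix ι ι ℝ)
    (hM : M ∈ doublyStochastic ℝ ι) (C : ι → ι → ℝ) :
    ∃ σ : Equiv.Perm ι, ∑ i, C i (σ i) ≤ ∑ i, ∑ j, M i j * C i j := by
  obtain ⟨w, hw0, hw1, hw⟩ := exists_eq_sum_perm_of_mem_doublyStochastic hM
  by_contra! hcon
  have e1 : ∑ i, ∑ j, M i j * C i j = ∑ σ, w σ * ∑ i, C i (σ i) := by
    rw [← hw]
    simp only [Matrix.sum_apply, Matrix.smul_apply, smul_eq_mul, Finset.sum_mul]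
    rw [Finset.sum_congr rfl fun i _ => Finset.sum_comm, Finset.sum_comm]
    refine Finset.sum_congr rfl fun σ _ => ?_
    rw [Finset.mul_sum]
    refine Finset.sum_congr rfl fun i _ => ?_
    simp [Equiv.Perm.permMatrix, PEquiv.toMatrix_apply]
  have e2 : ∑ σ, w σ * (∑ i, C i (σ i) - ∑ i, ∑ j, M i j * C i j) = 0 := by
    simp only [mul_sub, Finset.sum_sub_distrib, ← Finset.sum_mul, hw1, ← e1, one_mul, sub_self]
  have e3 := (Finset.sum_eq_zero_iff_of_nonneg (fun σ _ =>
    mul_nonneg (hw0 σ) (sub_nonneg.mpr (hcon σ).le))).mp e2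
  have e4 : ∑ σ, w σ = 0 := Finset.sum_eq_zero fun σ hσ => by
    have := e3 σ hσ
    rcases mul_eq_zero.mp this with h | h
    · exact h
    · linarith [hcon σ]
  linarith

lemma aux_hw {ι : Type*} [Fintype ι] [DecidableEq ι] (W : ι → ι → ℝ) (hW : ∀ i j, 0 ≤ W i j)
    (hr : ∀ i, ∑ j, W i j ≤ 1) (hc : ∀ j, ∑ i, W i j ≤ 1) (m n : ι → ℝ) :
    ∃ σ : Equiv.Perm (ι ⊕ ι),
      ∑ i, (Sum.elim m 0 i - Sum.elim n 0 (σ i) : ℝ) ^ 2 ≤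
      ∑ i, ∑ j, W i j * (m i - n j) ^ 2 + (∑ i, m i ^ 2 - ∑ i, ∑ j, W i j * m i ^ 2) +
        (∑ j, n j ^ 2 - ∑ i, ∑ j, W i j * n j ^ 2) := by
  let M : Matrix (ι ⊕ ι) (ι ⊕ ι) ℝ := Matrix.fromBlocks (Matrix.of W)
    (Matrix.diagonal fun i => 1 - ∑ j, W i j) (Matrix.diagonal fun j => 1 - ∑ i, W i j)
    (Matrix.of fun j i => W i j)
  have hM : M ∈ doublyStochastic ℝ (ι ⊕ ι) := by
    rw [mem_doublyStochastic_iff_sum]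
    refine ⟨?_, ?_, ?_⟩
    · rintro (i | i) (j | j)
      · exact hW i j
      · simp only [M, Matrix.fromBlocks_apply₁₂, Matrix.diagonal_apply]
        split_ifs
        · linarith [hr i]
        · exact le_rfl
      · simp only [M, Matrix.fromBlocks_apply₂₁, Matrix.diagonal_apply]
        split_ifs
        · linarith [hc i]
        · exact le_rfl
      · exact hW j i
    · rintro (i | i) <;> simp [M, Matrix.diagonal_apply]
    · rintro (i | i) <;> simp [M, Matrix.diagonal_apply]
  obtain ⟨σ, hσ⟩ := aux_birkhoff M hM (fun i j => (Sum.elim m 0 i - Sum.elim n 0 j : ℝ) ^ 2)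
  refine ⟨σ, hσ.trans (le_of_eq ?_)⟩
  have e : ∑ i, ∑ j, W i j * n j ^ 2 = ∑ j, (∑ i, W i j) * n j ^ 2 := by
    rw [Finset.sum_comm]; simp [Finset.sum_mul]
  rw [e]
  simp [M, Matrix.diagonal_apply, Finset.sum_add_distrib, sub_mul, Finset.sum_sub_distrib,
    Finset.sum_mul]
  try ring

lemma aux_prod {ι : Type*} (s : Finset ι) (F G : ι → ℂ) (p d : ι → ℝ) (hd : ∀ i, 0 ≤ d i)
    (hF : ∀ i, ‖F i‖ ≤ Real.exp (p i)) (hG : ∀ i, ‖G i‖ ≤ Real.exp (p i))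
    (hFG : ∀ i, ‖F i - G i‖ ≤ d i * Real.exp (p i)) :
    ‖∏ i ∈ s, F i - ∏ i ∈ s, G i‖ ≤ (∑ i ∈ s, d i) * Real.exp (∑ i ∈ s, p i) := by
  classical
  induction s using Finset.induction_on with
  | empty => simp
  | insert a s ha ih =>
    rw [Finset.prod_insert ha, Finset.prod_insert ha, Finset.sum_insert ha, Finset.sum_insert ha]
    have hP : ‖∏ i ∈ s, G i‖ ≤ Real.exp (∑ i ∈ s, p i) := by
      rw [norm_prod, Real.exp_sum]
      exact Finset.prod_le_prod (fun _ _ => norm_nonneg _) fun i _ => hG i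
    have e : F a * ∏ i ∈ s, F i - G a * ∏ i ∈ s, G i =
      F a * (∏ i ∈ s, F i - ∏ i ∈ s, G i) + (F a - G a) * ∏ i ∈ s, G i := by ring
    rw [e, Real.exp_add]
    refine (norm_add_le _ _).trans ?_
    rw [norm_mul, norm_mul]
    have h1 := mul_le_mul (hF a) ih (norm_nonneg _) (Real.exp_pos _).le
    have h2 := mul_le_mul (hFG a) hP (norm_nonneg _) (mul_nonneg (hd a) (Real.exp_pos _).le)
    refine (add_le_add h1 h2).trans (le_of_eq ?_)
    ring

lemma aux_f_norm (a : ℂ) : ‖(1 - a) * Complex.exp a‖ ≤ Real.exp (‖a‖ ^ 2) := by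
  have h1 : ‖1 - a‖ ^ 2 ≤ Real.exp (-2 * a.re + ‖a‖ ^ 2) := by
    refine le_trans (le_of_eq ?_) (Real.add_one_le_exp _)
    rw [Complex.sq_norm, Complex.sq_norm, Complex.normSq_apply, Complex.normSq_apply]
    simp; ring
  have h2 : ‖(1 - a) * Complex.exp a‖ ^ 2 ≤ Real.exp (‖a‖ ^ 2) ^ 2 := by
    rw [norm_mul, Complex.norm_exp, mul_pow, ← Real.exp_nat_mul, ← Real.exp_nat_mul]
    calc _ ≤ Real.exp (-2 * a.re + ‖a‖ ^ 2) * Real.exp (((2:ℕ):ℝ) * a.re) := by gcongr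
      _ ≤ _ := by
        rw [← Real.exp_add]
        apply Real.exp_le_exp.mpr
        push_cast
        nlinarith [sq_nonneg ‖a‖]
  exact le_of_sq_le_sq h2 (Real.exp_pos _).le

lemma aux_f_deriv (a : ℂ) :
    HasDerivAt (fun a : ℂ => (1 - a) * Complex.exp a) (-a * Complex.exp a) a := by
  have := ((hasDerivAt_id a).const_sub 1).mul (Complex.hasDerivAt_exp a)
  refine this.congr_deriv ?_
  simp; ring

lemma aux_f_sub (a b : ℂ) : ‖(1 - a) * Complex.exp a - (1 - b) * Complex.exp b‖ ≤
    Real.exp 1 * (‖a - b‖ * (‖a‖ + ‖b‖)) * Real.exp (‖a‖ ^ 2 + ‖b‖ ^ 2) := by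
  set m := max ‖a‖ ‖b‖ with hm
  have h := (convex_closedBall (0:ℂ) m).norm_image_sub_le_of_norm_hasDerivWithin_le
    (f := fun a : ℂ => (1 - a) * Complex.exp a) (C := m * Real.exp m) (x := b) (y := a)
    (fun x _ => (aux_f_deriv x).hasDerivWithinAt) (fun x hx => by
      have hx : ‖x‖ ≤ m := by simpa using hx
      rw [norm_mul, norm_neg, Complex.norm_exp]
      gcongr
      exact (Complex.re_le_norm x).trans hx)
    (by simp [hm]) (by simp [hm])
  refine h.trans ?_
  have hm0 : 0 ≤ m := le_max_of_le_left (norm_nonneg a)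
  have h1 : m ≤ ‖a‖ + ‖b‖ := max_le (by simp) (by simp)
  have h2 : m ^ 2 ≤ ‖a‖ ^ 2 + ‖b‖ ^ 2 := by
    rcases max_choice ‖a‖ ‖b‖ with h | h <;> rw [hm, h] <;> nlinarith [sq_nonneg ‖a‖, sq_nonneg ‖b‖]
  have h3 : Real.exp m ≤ Real.exp 1 * Real.exp (‖a‖ ^ 2 + ‖b‖ ^ 2) := by
    rw [← Real.exp_add]
    apply Real.exp_le_exp.mpr
    nlinarith [sq_nonneg (m - 1)]
  calc _ ≤ (‖a‖ + ‖b‖) * (Real.exp 1 * Real.exp (‖a‖ ^ 2 + ‖b‖ ^ 2)) * ‖a - b‖ := by gcongr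
    _ = _ := by ring

lemma aux_finite (s : Finset ℤ) (W : ℤ → ℤ → ℝ) (hW : ∀ i j, 0 ≤ W i j)
    (hr : ∀ i, ∑ j ∈ s, W i j ≤ 1) (hc : ∀ j, ∑ i ∈ s, W i j ≤ 1) (m n : ℤ → ℝ) (z : ℂ) :
    ‖∏ k ∈ s, ((1 - z * (m k : ℂ)) * Complex.exp (z * (m k : ℂ))) -
      ∏ k ∈ s, ((1 - z * (n k : ℂ)) * Complex.exp (z * (n k : ℂ)))‖ ≤
    ‖z‖ * Real.sqrt (∑ p ∈ s ×ˢ s, W p.1 p.2 * (m p.1 - n p.2) ^ 2 +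
      (∑ i ∈ s, m i ^ 2 - ∑ p ∈ s ×ˢ s, W p.1 p.2 * m p.1 ^ 2) +
      (∑ i ∈ s, n i ^ 2 - ∑ p ∈ s ×ˢ s, W p.1 p.2 * n p.2 ^ 2)) *
      Real.exp (1 + 2 * (‖z‖ ^ 2 * (∑ i ∈ s, m i ^ 2 + ∑ i ∈ s, n i ^ 2))) := by
  obtain ⟨σ, hσ⟩ := aux_hw (ι := s) (fun i j => W i j) (fun i j => hW i j)
    (fun i => by rw [Finset.sum_coe_sort s (fun j => W i j)]; exact hr i)
    (fun j => by rw [Finset.sum_coe_sort s (fun i => W i j)]; exact hc j)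
    (fun i => m i) (fun i => n i)
  have conv : ∀ f : ℤ → ℤ → ℝ, ∑ i : s, ∑ j : s, f i j = ∑ p ∈ s ×ˢ s, f p.1 p.2 := by
    intro f
    rw [Finset.sum_product, ← Finset.sum_coe_sort s]
    refine Finset.sum_congr rfl fun i _ => ?_
    rw [← Finset.sum_coe_sort s]
  rw [conv fun i j => W i j * (m i - n j) ^ 2, conv fun i j => W i j * m i ^ 2,
    conv fun i j => W i j * n j ^ 2, Finset.sum_coe_sort s (fun i => m i ^ 2),
    Finset.sum_coe_sort s (fun i => n i ^ 2)] at hσ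
  set cost := ∑ p ∈ s ×ˢ s, W p.1 p.2 * (m p.1 - n p.2) ^ 2 +
      (∑ i ∈ s, m i ^ 2 - ∑ p ∈ s ×ˢ s, W p.1 p.2 * m p.1 ^ 2) +
      (∑ i ∈ s, n i ^ 2 - ∑ p ∈ s ×ˢ s, W p.1 p.2 * n p.2 ^ 2) with hcost
  set S := ∑ i ∈ s, m i ^ 2 + ∑ i ∈ s, n i ^ 2 with hS
  let u : s ⊕ s → ℝ := Sum.elim (fun i => m i) 0
  let v : s ⊕ s → ℝ := Sum.elim (fun i => n i) 0
  let f : ℂ → ℂ := fun a => (1 - a) * Complex.exp a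
  have hu : ∏ i, f (z * (u i : ℂ)) = ∏ k ∈ s, ((1 - z * (m k : ℂ)) * Complex.exp (z * (m k : ℂ))) := by
    rw [← Finset.prod_coe_sort s]
    simp [f, u]
  have hv : ∏ i, f (z * (v (σ i) : ℂ)) =
      ∏ k ∈ s, ((1 - z * (n k : ℂ)) * Complex.exp (z * (n k : ℂ))) := by
    rw [Equiv.prod_comp σ (fun i => f (z * (v i : ℂ))), ← Finset.prod_coe_sort s]
    simp [f, v]
  have hu2 : ∑ i, u i ^ 2 = ∑ i ∈ s, m i ^ 2 := by
    rw [← Finset.sum_coe_sort s]; simp [u]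
  have hv2 : ∑ i, v (σ i) ^ 2 = ∑ i ∈ s, n i ^ 2 := by
    rw [Equiv.sum_comp σ (fun i => v i ^ 2), ← Finset.sum_coe_sort s]; simp [v]
  have key := aux_prod Finset.univ (fun i => f (z * (u i : ℂ))) (fun i => f (z * (v (σ i) : ℂ)))
    (fun i => ‖z * (u i : ℂ)‖ ^ 2 + ‖z * (v (σ i) : ℂ)‖ ^ 2)
    (fun i => Real.exp 1 * (‖z * (u i : ℂ) - z * (v (σ i) : ℂ)‖ *
      (‖z * (u i : ℂ)‖ + ‖z * (v (σ i) : ℂ)‖)))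
    (fun i => by positivity)
    (fun i => (aux_f_norm _).trans (Real.exp_le_exp.mpr (by simp; positivity)))
    (fun i => (aux_f_norm _).trans (Real.exp_le_exp.mpr (by simp; positivity)))
    (fun i => aux_f_sub _ _)
  rw [hu, hv] at key
  refine key.trans ?_
  have hp : ∑ i, (‖z * (u i : ℂ)‖ ^ 2 + ‖z * (v (σ i) : ℂ)‖ ^ 2) = ‖z‖ ^ 2 * S := by
    simp only [norm_mul, Complex.norm_real, mul_pow, Real.norm_eq_abs, sq_abs,
      Finset.sum_add_distrib, ← Finset.mul_sum]
    rw [hu2, hv2, hS]; ring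
  rw [hp, ← Finset.mul_sum]
  set T := ‖z‖ ^ 2 * S with hT
  have hS0 : 0 ≤ S := by positivity
  have hT0 : 0 ≤ T := by positivity
  have hd : ∑ i, ‖z * (u i : ℂ) - z * (v (σ i) : ℂ)‖ * (‖z * (u i : ℂ)‖ + ‖z * (v (σ i) : ℂ)‖) ≤
      (‖z‖ * Real.sqrt cost) * Real.exp T := by
    refine (Real.sum_mul_le_sqrt_mul_sqrt _ _ _).trans ?_
    have e1 : ∑ i, ‖z * (u i : ℂ) - z * (v (σ i) : ℂ)‖ ^ 2 = ‖z‖ ^ 2 * ∑ i, (u i - v (σ i)) ^ 2 := by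
      rw [Finset.mul_sum]
      refine Finset.sum_congr rfl fun i _ => ?_
      rw [← mul_sub, norm_mul, ← Complex.ofReal_sub, Complex.norm_real, mul_pow, Real.norm_eq_abs,
        sq_abs]
    have e2 : ∑ i, (‖z * (u i : ℂ)‖ + ‖z * (v (σ i) : ℂ)‖) ^ 2 ≤ 2 * T := by
      rw [← hp, Finset.mul_sum]
      refine Finset.sum_le_sum fun i _ => ?_
      nlinarith [sq_nonneg (‖z * (u i : ℂ)‖ - ‖z * (v (σ i) : ℂ)‖)]
    gcongr
    · rw [e1, Real.sqrt_mul (by positivity), Real.sqrt_sq (norm_nonneg _)]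
      gcongr
    · apply Real.sqrt_le_iff.mpr
      refine ⟨(Real.exp_pos _).le, e2.trans ?_⟩
      rw [← Real.exp_nat_mul]
      push_cast
      linarith [Real.add_one_le_exp (2 * T)]
  calc _ ≤ Real.exp 1 * ((‖z‖ * Real.sqrt cost) * Real.exp T) * Real.exp T := by gcongr
    _ = _ := by
      rw [two_mul, ← add_assoc, Real.exp_add, Real.exp_add]; ring

lemma aux_hasProd (m : ℤ → ℝ) (hm : Summable fun k => m k ^ 2) (z : ℂ) :
    HasProd (fun k => (1 - z * (m k : ℂ)) * Complex.exp (z * (m k : ℂ)))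
      (∏' k, (1 - z * (m k : ℂ)) * Complex.exp (z * (m k : ℂ))) := by
  apply Multipliable.hasProd
  have h : Summable fun k => ‖(1 - z * (m k : ℂ)) * Complex.exp (z * (m k : ℂ)) - 1‖ := by
    have hb : ∀ k, m k ^ 2 ≤ ∑' k, m k ^ 2 := fun k => hm.le_tsum k fun _ _ => sq_nonneg _
    refine Summable.of_nonneg_of_le (fun _ => norm_nonneg _) (fun k => ?_)
      (hm.mul_left (Real.exp 1 * ‖z‖ ^ 2 * Real.exp (‖z‖ ^ 2 * ∑' k, m k ^ 2)))
    have h1 := aux_f_sub (z * (m k : ℂ)) 0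
    simp only [sub_zero, norm_zero, add_zero, Complex.exp_zero, one_mul, norm_mul (z),
      Complex.norm_real, Real.norm_eq_abs, mul_pow, sq_abs, ne_eq, OfNat.ofNat_ne_zero,
      not_false_eq_true, zero_pow] at h1
    refine h1.trans ?_
    have h2 : Real.exp (‖z‖ ^ 2 * m k ^ 2) ≤ Real.exp (‖z‖ ^ 2 * ∑' k, m k ^ 2) := by
      apply Real.exp_le_exp.mpr
      gcongr
      exact hb k
    calc _ ≤ Real.exp 1 * (‖z‖ * |m k| * (‖z‖ * |m k|)) * Real.exp (‖z‖ ^ 2 * ∑' k, m k ^ 2) := by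
          gcongr
      _ = _ := by rw [← sq_abs (m k)]; ring
  have := multipliable_one_add_of_summable h
  simpa using this

lemma aux_limit (W : ℤ → ℤ → ℝ) (hW : ∀ i j, 0 ≤ W i j)
    (hr : ∀ i, HasSum (fun j => W i j) 1) (hc : ∀ j, HasSum (fun i => W i j) 1) (m n : ℤ → ℝ)
    (A B D : ℝ) (hA : HasSum (fun k => m k ^ 2) A) (hB : HasSum (fun k => n k ^ 2) B)
    (hD : HasSum (fun p : ℤ × ℤ => W p.1 p.2 * (m p.1 - n p.2) ^ 2) D) (z : ℂ) :
    ‖∏' k, ((1 - z * (m k : ℂ)) * Complex.exp (z * (m k : ℂ))) -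
      ∏' k, ((1 - z * (n k : ℂ)) * Complex.exp (z * (n k : ℂ)))‖ ≤
    ‖z‖ * Real.sqrt D * Real.exp (1 + 2 * (‖z‖ ^ 2 * (A + B))) := by
  have hA2 : HasSum (fun p : ℤ × ℤ => W p.1 p.2 * m p.1 ^ 2) A := by
    refine aux_hasSum_prod (fun p => mul_nonneg (hW _ _) (sq_nonneg _)) (fun a => ?_) hA
    simpa using (hr a).mul_right (m a ^ 2)
  have hB2 : HasSum (fun p : ℤ × ℤ => W p.1 p.2 * n p.2 ^ 2) B := by
    have : HasSum (fun p : ℤ × ℤ => W p.2 p.1 * n p.1 ^ 2) B := by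
      refine aux_hasSum_prod (fun p => mul_nonneg (hW _ _) (sq_nonneg _)) (fun a => ?_) hB
      simpa using (hc a).mul_right (n a ^ 2)
    exact (Equiv.prodComm ℤ ℤ).hasSum_iff.mpr this
  have hlim : Tendsto (fun s : Finset ℤ => s ×ˢ s) atTop atTop := by
    have h1 : Tendsto (fun s : Finset ℤ => (s, s)) atTop atTop := by
      rw [← prod_atTop_atTop_eq]
      exact tendsto_id.prodMk tendsto_id
    exact tendsto_finsetProd_atTop.comp h1
  have tA : Tendsto (fun s : Finset ℤ => ∑ i ∈ s, m i ^ 2) atTop (𝓝 A) := hA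
  have tB : Tendsto (fun s : Finset ℤ => ∑ i ∈ s, n i ^ 2) atTop (𝓝 B) := hB
  have tA2 := Tendsto.comp (show Tendsto _ atTop (𝓝 A) from hA2) hlim
  have tB2 := Tendsto.comp (show Tendsto _ atTop (𝓝 B) from hB2) hlim
  have tD := Tendsto.comp (show Tendsto _ atTop (𝓝 D) from hD) hlim
  have tC := (tD.add (tA.sub tA2)).add (tB.sub tB2)
  have tR := ((tC.sqrt).const_mul ‖z‖).mul
    ((Real.continuous_exp.tendsto _).comp (((((tA.add tB).const_mul (‖z‖ ^ 2))).const_mul 2).const_add 1))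
  have tL := (Tendsto.sub (show Tendsto _ atTop _ from aux_hasProd m hA.summable z)
    (show Tendsto _ atTop _ from aux_hasProd n hB.summable z)).norm
  have := le_of_tendsto_of_tendsto' tL tR (fun s => aux_finite s W hW
    (fun i => sum_le_hasSum s (fun j _ => hW i j) (hr i))
    (fun j => sum_le_hasSum s (fun i _ => hW i j) (hc j)) m n z)
  simpa using this

lemma aux_prod_bound (m : ℤ → ℝ) (A : ℝ) (hA : HasSum (fun k => m k ^ 2) A) (z : ℂ) :
    ‖∏' k, ((1 - z * (m k : ℂ)) * Complex.exp (z * (m k : ℂ)))‖ ≤ Real.exp (‖z‖ ^ 2 * A) := by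
  have tL := (show Tendsto _ atTop _ from aux_hasProd m hA.summable z).norm
  refine le_of_tendsto' tL fun s => ?_
  rw [norm_prod]
  refine (Finset.prod_le_prod (fun _ _ => norm_nonneg _) fun k _ => aux_f_norm _).trans ?_
  rw [← Real.exp_sum]
  apply Real.exp_le_exp.mpr
  simp only [norm_mul, Complex.norm_real, mul_pow, Real.norm_eq_abs, sq_abs, ← Finset.mul_sum]
  gcongr
  exact sum_le_hasSum s (fun _ _ => sq_nonneg _) hA



/-- Comparison of secular functions: there is a universal constant `a > 1` so that
for any two self-adjoint Hilbert–Schmidt operators `r₁, r₂` (with eigenvalue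
sequences `μ, ν` in orthonormal eigenbases) and integral traces `t₁, t₂`, the
secular functions `ζᵢ(z) = e^{-z tᵢ} det₂(I - z rᵢ) = e^{-z tᵢ} ∏_k (1 - z μ_k)e^{z μ_k}`
satisfy
`|ζ₁(z) - ζ₂(z)| ≤ (e^{|z||t₁-t₂|} - 1 + |z|‖r₁-r₂‖_HS) a^{|z|²(‖r₁‖²_HS + ‖r₂‖²_HS) + |z|(|t₁|+|t₂|) + 1}`. -/
theorem stmt19 :
    ∃ a : ℝ, 1 < a ∧
    ∀ (H : Type) [inst1 : NormedAddCommGroup H] [inst2 : InnerProductSpace ℝ H]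
      [inst3 : CompleteSpace H]
      (r₁ r₂ : H →L[ℝ] H) (e e₁ e₂ : HilbertBasis ℤ ℝ H) (μ ν : ℤ → ℝ) (t₁ t₂ : ℝ),
      IsSelfAdjoint r₁ → IsSelfAdjoint r₂ →
      (∀ k, r₁ (e₁ k) = μ k • e₁ k) → (∀ k, r₂ (e₂ k) = ν k • e₂ k) →
      Summable (fun k : ℤ => ‖r₁ (e k)‖ ^ 2) →
      Summable (fun k : ℤ => ‖r₂ (e k)‖ ^ 2) →
      Summable (fun k : ℤ => ‖(r₁ - r₂) (e k)‖ ^ 2) →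
      ∀ z : ℂ,
        ‖(Complex.exp (-z * (t₁ : ℂ)) *
            ∏' k : ℤ, (1 - z * (μ k : ℂ)) * Complex.exp (z * (μ k : ℂ))) -
          (Complex.exp (-z * (t₂ : ℂ)) *
            ∏' k : ℤ, (1 - z * (ν k : ℂ)) * Complex.exp (z * (ν k : ℂ)))‖ ≤
        (Real.exp (‖z‖ * |t₁ - t₂|) - 1 +
            ‖z‖ * Real.sqrt (∑' k : ℤ, ‖(r₁ - r₂) (e k)‖ ^ 2)) *
          a ^ (‖z‖ ^ 2 * ((∑' k : ℤ, ‖r₁ (e k)‖ ^ 2) + ∑' k : ℤ, ‖r₂ (e k)‖ ^ 2) +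
            ‖z‖ * (|t₁| + |t₂|) + 1) := by
  refine ⟨Real.exp 2, by simp, ?_⟩
  intro H _ _ _ r₁ r₂ e e₁ e₂ μ ν t₁ t₂ h1 h2 hμ hν s1 s2 s12 z
  set A := ∑' k : ℤ, ‖r₁ (e k)‖ ^ 2 with hAd
  set B := ∑' k : ℤ, ‖r₂ (e k)‖ ^ 2 with hBd
  set D := ∑' k : ℤ, ‖(r₁ - r₂) (e k)‖ ^ 2 with hDd
  have hA : HasSum (fun k => μ k ^ 2) A := by
    have := aux_hs r₁ h1 e e₁ s1.hasSum
    simpa [hμ, norm_smul, e₁.orthonormal.1] using this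
  have hB : HasSum (fun k => ν k ^ 2) B := by
    have := aux_hs r₂ h2 e e₂ s2.hasSum
    simpa [hν, norm_smul, e₂.orthonormal.1] using this
  have hA0 : 0 ≤ A := tsum_nonneg fun _ => sq_nonneg _
  have hB0 : 0 ≤ B := tsum_nonneg fun _ => sq_nonneg _
  have hD : HasSum (fun p : ℤ × ℤ => inner ℝ (e₁ p.1) (e₂ p.2) ^ 2 * (μ p.1 - ν p.2) ^ 2) D := by
    have hd := aux_hs (r₁ - r₂) (h1.sub h2) e e₂ s12.hasSum
    have : HasSum (fun p : ℤ × ℤ => inner ℝ (e₁ p.2) (e₂ p.1) ^ 2 * (μ p.2 - ν p.1) ^ 2) D := by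
      refine aux_hasSum_prod (fun p => by positivity) (fun k => ?_) hd
      have hp := aux_parseval e₁ ((r₁ - r₂) (e₂ k))
      have eq : (fun j => inner ℝ (e₁ j) ((r₁ - r₂) (e₂ k)) ^ 2) =
          fun j => inner ℝ (e₁ j) (e₂ k) ^ 2 * (μ j - ν k) ^ 2 := by
        funext j
        have hsym : inner ℝ (r₁ (e₁ j)) (e₂ k) = inner ℝ (e₁ j) (r₁ (e₂ k)) :=
          (ContinuousLinearMap.isSelfAdjoint_iff_isSymmetric.mp h1) (e₁ j) (e₂ k)
        rw [hμ, real_inner_smul_left] at hsym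
        rw [sub_apply, inner_sub_right, ← hsym, hν, real_inner_smul_right]
        ring
      rw [eq] at hp
      exact hp
    exact (Equiv.prodComm ℤ ℤ).hasSum_iff.mpr this
  have hr : ∀ i, HasSum (fun j => inner ℝ (e₁ i) (e₂ j) ^ 2) 1 := by
    intro i
    have := aux_parseval e₂ (e₁ i)
    simpa [e₁.orthonormal.1, real_inner_comm] using this
  have hc : ∀ j, HasSum (fun i => inner ℝ (e₁ i) (e₂ j) ^ 2) 1 := by
    intro j
    have := aux_parseval e₁ (e₂ j)
    simpa [e₂.orthonormal.1] using this
  have hP := aux_limit (fun i j => inner ℝ (e₁ i) (e₂ j) ^ 2) (fun _ _ => sq_nonneg _) hr hc μ ν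
    A B D hA hB hD z
  have hP2 := aux_prod_bound ν B hB z
  set P₁ := ∏' k : ℤ, (1 - z * (μ k : ℂ)) * Complex.exp (z * (μ k : ℂ))
  set P₂ := ∏' k : ℤ, (1 - z * (ν k : ℂ)) * Complex.exp (z * (ν k : ℂ))
  have hexp : ∀ t : ℝ, ‖Complex.exp (-z * (t : ℂ))‖ ≤ Real.exp (‖z‖ * |t|) := by
    intro t
    rw [Complex.norm_exp]
    apply Real.exp_le_exp.mpr
    refine (Complex.re_le_norm _).trans (le_of_eq ?_)
    simp
  have hdiff : ‖Complex.exp (-z * (t₁ : ℂ)) - Complex.exp (-z * (t₂ : ℂ))‖ ≤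
      Real.exp (‖z‖ * |t₂|) * (Real.exp (‖z‖ * |t₁ - t₂|) - 1) := by
    have eq : Complex.exp (-z * (t₁ : ℂ)) - Complex.exp (-z * (t₂ : ℂ)) =
        Complex.exp (-z * (t₂ : ℂ)) * (Complex.exp (-z * ((t₁ - t₂ : ℝ) : ℂ)) - 1) := by
      rw [mul_sub, ← Complex.exp_add, mul_one]
      congr 2
      push_cast; ring
    rw [eq, norm_mul]
    refine mul_le_mul (hexp t₂) ?_ (norm_nonneg _) (Real.exp_pos _).le
    have := Complex.norm_exp_sub_sum_le_exp_norm_sub_sum (-z * ((t₁ - t₂ : ℝ) : ℂ)) 1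
    simpa [← Complex.ofReal_sub, -Complex.ofReal_sub] using this
  rw [← Real.exp_mul]
  set X := ‖z‖ ^ 2 * (A + B) + ‖z‖ * (|t₁| + |t₂|) + 1 with hX
  set E := Real.exp (‖z‖ * |t₁ - t₂|) - 1
  have hE : 0 ≤ E := by
    have : (1:ℝ) ≤ Real.exp (‖z‖ * |t₁ - t₂|) := Real.one_le_exp (by positivity)
    simp only [E]; linarith
  have q1 : 0 ≤ ‖z‖ ^ 2 * A := by positivity
  have q2 : 0 ≤ ‖z‖ ^ 2 * B := by positivity
  have q3 : 0 ≤ ‖z‖ * |t₁| := by positivity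
  have q4 : 0 ≤ ‖z‖ * |t₂| := by positivity
  have eq : Complex.exp (-z * (t₁ : ℂ)) * P₁ - Complex.exp (-z * (t₂ : ℂ)) * P₂ =
      (Complex.exp (-z * (t₁ : ℂ)) - Complex.exp (-z * (t₂ : ℂ))) * P₂ +
      Complex.exp (-z * (t₁ : ℂ)) * (P₁ - P₂) := by ring
  rw [eq]
  refine (norm_add_le _ _).trans ?_
  rw [norm_mul, norm_mul, add_mul]
  refine add_le_add ?_ ?_
  · refine (mul_le_mul hdiff hP2 (norm_nonneg _) (by positivity)).trans ?_
    calc _ = E * Real.exp (‖z‖ * |t₂| + ‖z‖ ^ 2 * B) := by rw [Real.exp_add]; ring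
      _ ≤ _ := by
        gcongr
        rw [hX]; nlinarith
  · refine (mul_le_mul (hexp t₁) hP (norm_nonneg _) (Real.exp_pos _).le).trans ?_
    calc _ = ‖z‖ * Real.sqrt D *
          Real.exp (‖z‖ * |t₁| + (1 + 2 * (‖z‖ ^ 2 * (A + B)))) := by
            rw [Real.exp_add (‖z‖ * |t₁|)]; ring
      _ ≤ _ := by
        gcongr
        rw [hX]; nlinarith
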